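/- Two shift-homogeneous boundedly-finite metric spaces X and Y are coarsely equivalent if and only if their factorizing components X_{s(X)} and Y_{s(Y)} are coarsely equivalent and the spaces X, Y either both are large scale connected or both are not large scale connected. -/

import Mathlib

open scoped ENNReal symmDiff

noncomputable section

/-- The supremum in `ℕ∞` of a set of natural numbers. -/
def natSup (s : Set ℕ) : ℕ∞ := sSup ((↑) '' s : Set ℕ∞)

/-- The `ε`-connected component of a point `x`: all points linkable to `x` by a chain with
consecutive distances `≤ ε` (for `ε = ∞` this is the whole space). -/
def comp (X : Type*) [MetricSpace X] (ε : ℝ≥0∞) (x : X) : Set X :=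
  {y | Relation.ReflTransGen (fun a b => edist a b ≤ ε) x y}

/-- `ss X` is the set of `ε ∈ [0,∞]` such that for every finite `δ ≥ ε` and every point `x` the
set `{X_ε(y) : y ∈ X_δ(x)}` of `ε`-components of points of `X_δ(x)` is finite. -/
def ssSet (X : Type*) [MetricSpace X] : Set ℝ≥0∞ :=
  {ε | ∀ δ : ℝ≥0∞, δ ≠ ⊤ → ε ≤ δ → ∀ x : X, ((comp X ε) '' (comp X δ x)).Finite}

/-- The factorizing step `s(X) = inf ss(X)`. -/
def sStep (X : Type*) [MetricSpace X] : ℝ≥0∞ := sInf (ssSet X)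

/-- A metric space is boundedly-finite if every bounded subset is finite. -/
def BoundedlyFinite (X : Type*) [MetricSpace X] : Prop :=
  ∀ s : Set X, Bornology.IsBounded s → s.Finite

/-- A metric space is homogeneous if for any two points there is a bijective self-isometry
moving one to the other. -/
def Homogeneous (X : Type*) [MetricSpace X] : Prop :=
  ∀ x y : X, ∃ f : X ≃ᵢ X, f x = y

/-- A subset `C` is large scale connected if any two of its points can be linked by an
`ε`-chain for a common finite `ε`. -/
def IsLSCSet {X : Type*} [MetricSpace X] (C : Set X) : Prop :=
  ∃ ε : ℝ≥0∞, ε ≠ ⊤ ∧ ∀ x ∈ C, ∀ y ∈ C, y ∈ comp X ε x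

/-- A metric space is large scale connected if it coincides with an `ε`-connected component
for some finite `ε`. -/
def LargeScaleConnected (X : Type*) [MetricSpace X] : Prop :=
  ∃ ε : ℝ≥0∞, ε ≠ ⊤ ∧ ∀ x y : X, y ∈ comp X ε x

/-- A metric space is shift-homogeneous if any point can be moved to any other point by a
bijective self-isometry whose displacement is bounded on each large scale connected subset. -/
def ShiftHomogeneous (X : Type*) [MetricSpace X] : Prop :=
  ∀ x y : X, ∃ f : X ≃ᵢ X, f x = y ∧
    ∀ C : Set X, IsLSCSet C → ∃ M : ℝ, ∀ c ∈ C, dist (f c) c ≤ M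

/-- The oscillation `ω_f(δ) = sup {d (f x) (f x') : d x x' ≤ δ}` of a map, in `[0,∞]`. -/
def osc {X Y : Type*} [MetricSpace X] [MetricSpace Y] (f : X → Y) (δ : ℝ≥0∞) : ℝ≥0∞ :=
  ⨆ (x : X) (x' : X) (_ : edist x x' ≤ δ), edist (f x) (f x')

/-- A map between metric spaces is coarse if its oscillation at each finite `δ` is finite. -/
def CoarseMapM {X Y : Type*} [MetricSpace X] [MetricSpace Y] (f : X → Y) : Prop :=
  ∀ δ : ℝ≥0∞, δ ≠ ⊤ → osc f δ ≠ ⊤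

/-- Two metric spaces are coarsely isomorphic if there is a bijection between them which is
coarse in both directions. -/
def CoarselyIsomorphic (X Y : Type*) [MetricSpace X] [MetricSpace Y] : Prop :=
  ∃ f : X ≃ Y, CoarseMapM ⇑f ∧ CoarseMapM ⇑f.symm

/-- Two metric spaces are coarsely equivalent if there are coarse maps in both directions whose
compositions are within finite distance of the identities. -/
def CoarselyEquivalent (X Y : Type*) [MetricSpace X] [MetricSpace Y] : Prop :=
  ∃ f : X → Y, CoarseMapM f ∧ ∃ g : Y → X, CoarseMapM g ∧
    (∃ M : ℝ, ∀ x : X, dist x (g (f x)) ≤ M) ∧ (∃ M : ℝ, ∀ y : Y, dist y (f (g y)) ≤ M)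

/-- A metric on a group is left-invariant if left translations are isometries. -/
def LeftInvariantMetric (G : Type*) [Group G] [MetricSpace G] : Prop :=
  ∀ g x y : G, dist (g * x) (g * y) = dist x y

/-- A metric on a countable space is proper if all closed balls are finite. -/
def ProperMetric (X : Type*) [MetricSpace X] : Prop :=
  ∀ (x : X) (r : ℝ), (Metric.closedBall x r).Finite

open scoped NNReal

section Comp

variable {X : Type*} [MetricSpace X]

lemma mem_comp_self (ε : ℝ≥0∞) (x : X) : x ∈ comp X ε x := Relation.ReflTransGen.refl

lemma mem_comp_symm {ε : ℝ≥0∞} {x y : X} (h : y ∈ comp X ε x) : x ∈ comp X ε y :=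
  have : Std.Symm (fun a b : X => edist a b ≤ ε) := ⟨fun a b hab => by rwa [edist_comm]⟩
  (Relation.ReflTransGen.stdSymm (r := fun a b : X => edist a b ≤ ε)).symm x y h

lemma mem_comp_trans {ε : ℝ≥0∞} {x y z : X} (h : y ∈ comp X ε x) (h' : z ∈ comp X ε y) :
    z ∈ comp X ε x :=
  Relation.ReflTransGen.trans h h'

lemma mem_comp_mono {ε ε' : ℝ≥0∞} (hε : ε ≤ ε') {x y : X} (h : y ∈ comp X ε x) :
    y ∈ comp X ε' x :=
  Relation.ReflTransGen.mono (r := fun a b : X => edist a b ≤ ε)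
    (fun _ _ hab => le_trans hab hε) x y h

lemma mem_comp_of_edist_le {ε : ℝ≥0∞} {x y : X} (h : edist x y ≤ ε) : y ∈ comp X ε x :=
  Relation.ReflTransGen.single h

lemma mem_comp_of_dist_le {r : ℝ≥0} {x y : X} (h : dist x y ≤ r) :
    y ∈ comp X (r : ℝ≥0∞) x :=
  mem_comp_of_edist_le (by rw [edist_nndist]; exact_mod_cast h)

lemma comp_eq_comp_iff {ε : ℝ≥0∞} {x y : X} : comp X ε x = comp X ε y ↔ y ∈ comp X ε x := by
  constructor
  · intro h
    rw [h]
    exact mem_comp_self ε y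
  · intro h
    ext z
    exact ⟨mem_comp_trans (mem_comp_symm h), mem_comp_trans h⟩

lemma isometryEquiv_mem_comp (f : X ≃ᵢ X) {ε : ℝ≥0∞} {x y : X} (h : y ∈ comp X ε x) :
    f y ∈ comp X ε (f x) :=
  Relation.ReflTransGen.lift (r := fun a b : X => edist a b ≤ ε)
    (p := fun a b : X => edist a b ≤ ε) f (fun a b hab => (f.edist_eq a b).trans_le hab) x y h

lemma isometryEquiv_mem_comp_iff (f : X ≃ᵢ X) {ε : ℝ≥0∞} {x y : X} :
    f y ∈ comp X ε (f x) ↔ y ∈ comp X ε x :=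
  ⟨fun h => by simpa using isometryEquiv_mem_comp f.symm h, isometryEquiv_mem_comp f⟩

lemma isLSCSet_comp (r : ℝ≥0) (x : X) : IsLSCSet (comp X (r : ℝ≥0∞) x) :=
  ⟨r, ENNReal.coe_ne_top, fun _ ha _ hb => mem_comp_trans (mem_comp_symm ha) hb⟩

/-- Being in the same `r`-connected component. -/
def compSetoid (X : Type*) [MetricSpace X] (r : ℝ≥0) : Setoid X where
  r x y := y ∈ comp X (r : ℝ≥0∞) x
  iseqv := ⟨fun x => mem_comp_self _ x, mem_comp_symm, mem_comp_trans⟩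

lemma compSetoid_mono {r r' : ℝ≥0} (h : r ≤ r') : compSetoid X r ≤ compSetoid X r' :=
  fun _ _ hxy => mem_comp_mono (by exact_mod_cast h) hxy

lemma ssSet_mono {ε ε' : ℝ≥0∞} (hε : ε ∈ ssSet X) (h : ε ≤ ε') : ε' ∈ ssSet X := by
  intro δ hδ hle x
  refine ((hε δ hδ (h.trans hle) x).image (fun A => ⋃ z ∈ A, comp X ε' z)).subset ?_
  rintro _ ⟨y, hy, rfl⟩
  refine ⟨_, ⟨y, hy, rfl⟩, ?_⟩
  ext z
  simp only [Set.mem_iUnion, exists_prop]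
  constructor
  · rintro ⟨w, hw, hz⟩
    exact mem_comp_trans (mem_comp_mono h hw) hz
  · intro hz
    exact ⟨y, mem_comp_self _ _, hz⟩

lemma top_mem_ssSet : (⊤ : ℝ≥0∞) ∈ ssSet X :=
  fun _ hδ hle => absurd (top_le_iff.1 hle) hδ

lemma ShiftHomogeneous.homogeneous (hX : ShiftHomogeneous X) : Homogeneous X := fun x y => by
  obtain ⟨f, hf, -⟩ := hX x y
  exact ⟨f, hf⟩

/-- The possible distances in a homogeneous boundedly-finite space are discrete, so components do
not change at scales slightly bigger than a given one. -/
lemma exists_gt_comp_eq (hX : Homogeneous X) (hb : BoundedlyFinite X) (s : ℝ≥0) :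
    ∃ η : ℝ≥0∞, (s : ℝ≥0∞) < η ∧ ∀ x : X, comp X η x ⊆ comp X s x := by
  rcases isEmpty_or_nonempty X with hE | ⟨⟨x₀⟩⟩
  · exact ⟨⊤, ENNReal.coe_lt_top, fun x => isEmptyElim x⟩
  have hfin : (Metric.closedBall x₀ ((s : ℝ) + 1)).Finite := hb _ Metric.isBounded_closedBall
  have hfin' : ((fun y => nndist x₀ y) '' Metric.closedBall x₀ ((s : ℝ) + 1) ∩
      Set.Ioi s).Finite := (hfin.image _).inter_of_left _
  obtain ⟨η, hη, hsη, hlt⟩ : ∃ η : ℝ≥0, η ≤ s + 1 ∧ s < η ∧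
      ∀ t ∈ (fun y => nndist x₀ y) '' Metric.closedBall x₀ ((s : ℝ) + 1) ∩ Set.Ioi s, η < t := by
    obtain ⟨m, hm, hmin⟩ := (hfin'.insert (s + 1)).exists_minimal (Set.insert_nonempty _ _)
    have hsm : s < m := by
      rcases hm with rfl | hm
      · exact lt_add_one s
      · exact hm.2
    obtain ⟨η, h1, h2⟩ := exists_between hsm
    have hle : ∀ t ∈ insert (s + 1) ((fun y => nndist x₀ y) ''
        Metric.closedBall x₀ ((s : ℝ) + 1) ∩ Set.Ioi s), m ≤ t := fun t ht =>
      (le_total m t).elim id (fun h => hmin ht h)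
    exact ⟨η, h2.le.trans (hle _ (Set.mem_insert _ _)), h1,
      fun t ht => h2.trans_le (hle t (Set.mem_insert_of_mem _ ht))⟩
  refine ⟨η, by exact_mod_cast hsη, fun x y hy => ?_⟩
  refine Relation.ReflTransGen.mono (r := fun a b : X => edist a b ≤ η) (fun a b hab => ?_) x y hy
  obtain ⟨f, hf⟩ := hX a x₀
  have hab' : nndist x₀ (f b) ≤ η := by
    rw [← hf, f.isometry.nndist_eq]
    replace hab : edist a b ≤ η := hab
    rw [edist_nndist] at hab
    exact_mod_cast hab
  have : nndist x₀ (f b) ≤ s := by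
    by_contra! hcon
    refine absurd hab' (not_le.2 (hlt _ ⟨⟨f b, ?_, rfl⟩, hcon⟩))
    rw [Metric.mem_closedBall, dist_comm]
    exact_mod_cast hab'.trans hη
  rw [← hf, f.isometry.nndist_eq] at this
  rw [edist_nndist]
  exact_mod_cast this

lemma sStep_mem_ssSet (hX : Homogeneous X) (hb : BoundedlyFinite X) : sStep X ∈ ssSet X := by
  by_cases htop : sStep X = ⊤
  · rw [htop]
    exact top_mem_ssSet
  obtain ⟨s, hs⟩ : ∃ s : ℝ≥0, (s : ℝ≥0∞) = sStep X :=
    ⟨_, ENNReal.coe_toNNReal htop⟩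
  rw [← hs]
  obtain ⟨η, hsη, hη⟩ := exists_gt_comp_eq hX hb s
  obtain ⟨e, he, heη⟩ := sInf_lt_iff.1 (show sStep X < η by rwa [← hs])
  have heq : ∀ ε : ℝ≥0∞, (s : ℝ≥0∞) ≤ ε → ε ≤ η → comp X ε = comp X s := by
    intro ε h1 h2
    ext x y
    exact ⟨fun h => hη x (mem_comp_mono h2 h), mem_comp_mono h1⟩
  have hse : (s : ℝ≥0∞) ≤ e := hs.trans_le (sInf_le he)
  intro δ hδ hle x
  rcases le_total e δ with h | h
  · rw [← heq e hse heη.le]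
    exact he δ hδ h x
  · rw [heq δ hle (h.trans heη.le)]
    refine (Set.finite_singleton (comp X (s : ℝ≥0∞) x)).subset ?_
    rintro _ ⟨y, hy, rfl⟩
    exact (comp_eq_comp_iff.2 hy).symm

lemma LargeScaleConnected.sStep_ne_top (h : LargeScaleConnected X) : sStep X ≠ ⊤ := by
  obtain ⟨ε, hε, h⟩ := h
  refine ne_top_of_le_ne_top hε (sInf_le ?_)
  intro δ _ _ x
  refine (Set.finite_singleton (comp X ε x)).subset ?_
  rintro _ ⟨y, hy, rfl⟩
  exact (comp_eq_comp_iff.2 (h x y)).symm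

lemma exists_mem_ssSet_of_sStep_ne_top (h : sStep X ≠ ⊤) : ∃ r : ℝ≥0, (r : ℝ≥0∞) ∈ ssSet X := by
  obtain ⟨e, he, hlt⟩ := sInf_lt_iff.1 (show sInf (ssSet X) < ⊤ from lt_top_iff_ne_top.2 h)
  exact ⟨e.toNNReal, by rwa [ENNReal.coe_toNNReal hlt.ne]⟩

/-- A component meets finitely many components of a scale in `ss X`. -/
lemma finite_image_mk_comp {r : ℝ≥0} (hr : (r : ℝ≥0∞) ∈ ssSet X) (r' : ℝ≥0) (x₀ : X) :
    (Quotient.mk (compSetoid X r) '' comp X r' x₀).Finite := by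
  have hmk : ∀ {x y : X}, Quotient.mk (compSetoid X r) x = Quotient.mk _ y ↔ y ∈ comp X r x :=
    Quotient.eq
  rcases le_total r r' with h | h
  · refine ((hr r' ENNReal.coe_ne_top (by exact_mod_cast h) x₀).preimage
      (f := fun q : Quotient (compSetoid X r) => comp X r q.out) fun q _ q' _ h => ?_).subset ?_
    · have := hmk.2 (comp_eq_comp_iff.1 h)
      rwa [Quotient.out_eq, Quotient.out_eq] at this
    · rintro _ ⟨x, hx, rfl⟩
      exact ⟨x, hx, comp_eq_comp_iff.2 (hmk.1 (Quotient.out_eq _).symm)⟩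
  · refine (Set.finite_singleton (Quotient.mk _ x₀)).subset ?_
    rintro _ ⟨x, hx, rfl⟩
    exact (hmk.2 (mem_comp_mono (by exact_mod_cast h) hx)).symm

/-- Shift-homogeneity provides a map onto a component that is close to the identity on every
bigger component, and is the restriction of an isometry on each component of the same scale. -/
lemma exists_retraction (hX : ShiftHomogeneous X) (x₀ : X) {r : ℝ≥0}
    (hr : (r : ℝ≥0∞) ∈ ssSet X) :
    ∃ ρ : X → X, (∀ x ∈ comp X r x₀, ρ x = x) ∧ (∀ x, ρ x ∈ comp X r x₀) ∧
      (∀ x, ∃ f : X ≃ᵢ X, ∀ x' ∈ comp X r x, ρ x' = f x') ∧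
      ∀ r' : ℝ≥0, ∃ R : ℝ, ∀ x ∈ comp X r' x₀, dist (ρ x) x ≤ R := by
  let mk : X → Quotient (compSetoid X r) := Quotient.mk _
  have hmk : ∀ {x y : X}, mk x = mk y ↔ y ∈ comp X r x := Quotient.eq
  have hout : ∀ x, (mk x).out ∈ comp X r x := fun x => hmk.1 (Quotient.out_eq (mk x)).symm
  have key : ∀ q : Quotient (compSetoid X r), ∃ f : X ≃ᵢ X,
      (q = mk x₀ → ∀ x, f x = x) ∧ f q.out ∈ comp X r x₀ ∧
      ∃ M : ℝ, ∀ c ∈ comp X r q.out, dist (f c) c ≤ M := by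
    intro q
    by_cases hq : q = mk x₀
    · refine ⟨IsometryEquiv.refl X, fun _ _ => rfl, ?_, 0, fun c _ => (dist_self c).le⟩
      rw [hq]
      exact hout x₀
    · obtain ⟨f, hf, hM⟩ := hX q.out x₀
      exact ⟨f, fun h => absurd h hq, hf ▸ mem_comp_self _ _, hM _ (isLSCSet_comp r _)⟩
  choose f hf1 hf2 M hM using key
  refine ⟨fun x => f (mk x) x, fun x hx => hf1 _ (hmk.2 (mem_comp_symm hx)) x, fun x => ?_,
    fun x => ⟨f (mk x), fun x' hx' => by rw [hmk.2 hx']⟩, fun r' => ?_⟩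
  · exact mem_comp_trans (hf2 (mk x)) (isometryEquiv_mem_comp _ (mem_comp_symm (hout x)))
  · obtain ⟨R, hR⟩ := ((finite_image_mk_comp hr r' x₀).image M).bddAbove
    refine ⟨R, fun x hx => ?_⟩
    exact (hM (mk x) x (mem_comp_symm (hout x))).trans (hR ⟨_, ⟨x, hx, rfl⟩, rfl⟩)

end Comp

section Projection

variable {X : Type*} [MetricSpace X]

/-- Along a tower of components, there is a projection onto the smallest one distorting distances
in a controlled way inside every stage, and surjective on every smallest component. -/
lemma exists_projection (hX : ShiftHomogeneous X) (x₀ : X) (p : ℕ → ℝ≥0) (hp : Monotone p)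
    (hss : (p 0 : ℝ≥0∞) ∈ ssSet X) (hex : ∀ x, ∃ n, x ∈ comp X (p n) x₀) :
    ∃ π : X → comp X (p 0) x₀, (∀ x z, ∃ x' ∈ comp X (p 0) x, π x' = z) ∧
      ∀ n, ∃ R : ℝ, ∀ x, ∀ x' ∈ comp X (p n) x, |dist (π x) (π x') - dist x x'| ≤ R := by
  have hmono : ∀ {m n : ℕ}, m ≤ n → ∀ {x y : X}, y ∈ comp X (p m) x → y ∈ comp X (p n) x :=
    fun h _ _ => mem_comp_mono (by exact_mod_cast hp h)
  choose ρ hfix hmem hiso hdisp using fun n =>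
    exists_retraction hX x₀ (ssSet_mono hss (ENNReal.coe_le_coe.2 (hp (Nat.zero_le n))))
  let P : ℕ → X → X := fun n => Nat.rec id (fun n f => f ∘ ρ n) n
  have hPs : ∀ n x, P (n + 1) x = P n (ρ n x) := fun _ _ => rfl
  have hstable : ∀ {m n : ℕ}, m ≤ n → ∀ x ∈ comp X (p m) x₀, P n x = P m x := by
    intro m n hmn x hx
    induction n, hmn using Nat.le_induction with
    | base => rfl
    | succ n hmn ih => rw [hPs, hfix n x (hmono hmn hx), ih]
  have hPiso : ∀ n x, ∃ f : X ≃ᵢ X, ∀ x' ∈ comp X (p 0) x, P n x' = f x' := by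
    intro n
    induction n with
    | zero => exact fun x => ⟨IsometryEquiv.refl X, fun _ _ => rfl⟩
    | succ n ih =>
      intro x
      obtain ⟨f, hf⟩ := hiso n x
      obtain ⟨g, hg⟩ := ih (f x)
      refine ⟨f.trans g, fun x' hx' => ?_⟩
      rw [hPs, hf x' (hmono (Nat.zero_le n) hx'), hg _ (isometryEquiv_mem_comp f hx')]
      rfl
  have hPmem : ∀ n, ∀ x ∈ comp X (p n) x₀, P n x ∈ comp X (p 0) x₀ := by
    intro n
    induction n with
    | zero => exact fun x hx => hx
    | succ n ih => exact fun x _ => ih _ (hmem n x)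
  have hPdisp : ∀ n m, ∃ R : ℝ, ∀ x ∈ comp X (p m) x₀, dist (P n x) x ≤ R := by
    intro n
    induction n with
    | zero => exact fun _ => ⟨0, fun x _ => (dist_self x).le⟩
    | succ n ih =>
      intro m
      obtain ⟨R, hR⟩ := ih n
      obtain ⟨R', hR'⟩ := hdisp n (p m)
      refine ⟨R + R', fun x hx => (dist_triangle _ (ρ n x) _).trans (add_le_add ?_ (hR' x hx))⟩
      exact hR _ (hmem n x)
  have hPdist : ∀ m n, m ≤ n → ∀ x, ∀ x' ∈ comp X (p m) x, ∃ y ∈ comp X (p m) x₀,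
      ∃ y' ∈ comp X (p m) x₀, dist y y' = dist x x' ∧ P (n + 1) x = P m y ∧
      P (n + 1) x' = P m y' := by
    intro m n hmn
    induction n, hmn using Nat.le_induction with
    | base =>
      intro x x' hx'
      obtain ⟨f, hf⟩ := hiso m x
      refine ⟨ρ m x, hmem m x, ρ m x', hmem m x', ?_, rfl, rfl⟩
      rw [hf x (mem_comp_self _ _), hf x' hx', f.dist_eq]
    | succ n hmn ih =>
      intro x x' hx'
      obtain ⟨f, hf⟩ := hiso (n + 1) x
      have h1 := hf x (mem_comp_self _ _)
      have h2 := hf x' (hmono (hmn.trans (Nat.le_succ n)) hx')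
      obtain ⟨y, hy, y', hy', h3, h4, h5⟩ := ih (f x) (f x') (isometryEquiv_mem_comp f hx')
      exact ⟨y, hy, y', hy', by rw [h3, f.dist_eq], (hPs (n + 1) x).trans (by rw [h1, h4]),
        (hPs (n + 1) x').trans (by rw [h2, h5])⟩
  choose N hN using hex
  have hπ : ∀ n, ∀ x ∈ comp X (p n) x₀, P (N x) x = P n x := fun n x hx =>
    (le_total n (N x)).elim (fun h => hstable h x hx) (fun h => (hstable h x (hN x)).symm)
  refine ⟨fun x => ⟨P (N x) x, hPmem _ _ (hN x)⟩, fun x z => ?_, fun n => ?_⟩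
  · obtain ⟨f, hf⟩ := hPiso (N x) x
    have hfx : f x ∈ comp X (p 0) x₀ := hf x (mem_comp_self _ _) ▸ hPmem _ _ (hN x)
    have hz' : f.symm z ∈ comp X (p 0) x := by
      rw [← isometryEquiv_mem_comp_iff f, f.apply_symm_apply]
      exact mem_comp_trans (mem_comp_symm hfx) z.2
    refine ⟨f.symm z, hz', ?_⟩
    have := hπ (N x) (f.symm z) (mem_comp_trans (hN x) (hmono (Nat.zero_le _) hz'))
    exact Subtype.ext (by simp only [this, hf _ hz', f.apply_symm_apply])
  · obtain ⟨R, hR⟩ := hPdisp n n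
    refine ⟨R + R, fun x x' hx' => ?_⟩
    have key : ∃ K, n ≤ K ∧ N x ≤ K + 1 ∧ N x' ≤ K + 1 := ⟨n + N x + N x', by omega⟩
    obtain ⟨K, h1, h2, h3⟩ := key
    obtain ⟨y, hy, y', hy', h4, h5, h6⟩ := hPdist n K h1 x x' hx'
    simp only [Subtype.dist_eq, hπ (K + 1) x (hmono h2 (hN x)), hπ (K + 1) x' (hmono h3 (hN x')),
      h5, h6, ← h4]
    have a1 := hR y hy
    have a2 := hR y' hy'
    have a3 := dist_triangle4 (P n y) y y' (P n y')
    have a4 := dist_triangle4 y (P n y) (P n y') y'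
    rw [dist_comm y' (P n y')] at a3
    rw [dist_comm y (P n y)] at a4
    rw [abs_le]
    constructor <;> linarith

end Projection

section Combinatorics

lemma exists_balanced_map {A B : Type*} [Finite A] [Finite B] {a b : ℕ}
    (h1 : Nat.card B * a ≤ Nat.card A) (h2 : Nat.card A ≤ Nat.card B * b) :
    ∃ φ : A → B, ∀ t, a ≤ Nat.card {s // φ s = t} ∧ Nat.card {s // φ s = t} ≤ b := by
  rcases Nat.eq_zero_or_pos (Nat.card B) with h0 | hpos
  · have hA : IsEmpty A := by
      rw [h0, zero_mul, Nat.le_zero] at h2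
      exact Finite.card_eq_zero_iff.1 h2
    have hB : IsEmpty B := Finite.card_eq_zero_iff.1 h0
    exact ⟨fun x => hA.elim x, fun t => hB.elim t⟩
  · have eA := Finite.equivFin A
    have eB := Finite.equivFin B
    generalize Nat.card A = n at *
    generalize Nat.card B = m at *
    refine ⟨fun x => eB.symm ⟨(eA x : ℕ) % m, Nat.mod_lt _ hpos⟩, fun t => ?_⟩
    have hcard : Nat.card {s // eB.symm ⟨(eA s : ℕ) % m, Nat.mod_lt _ hpos⟩ = t} =
        Nat.count (· ≡ (eB t : ℕ) [MOD m]) n := by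
      let _ := Nat.CountSet.fintype (· ≡ (eB t : ℕ) [MOD m]) n
      rw [Nat.count_eq_card_fintype, ← Nat.card_eq_fintype_card]
      refine Nat.card_congr ((Equiv.subtypeEquiv eA (p := fun s => _)
        (q := fun i : Fin n => (i : ℕ) ≡ (eB t : ℕ) [MOD m]) ?_).trans ?_)
      · intro s
        rw [Equiv.symm_apply_eq, Fin.ext_iff, Nat.ModEq, Nat.mod_eq_of_lt (eB t).2]
      · exact ⟨fun i => ⟨i.1, i.1.2, i.2⟩, fun i => ⟨⟨i.1, i.2.1⟩, i.2.2⟩,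
          fun _ => rfl, fun _ => rfl⟩
    rw [hcard, Nat.count_modEq_card n hpos]
    have hdm := Nat.div_add_mod n m
    have ha : a ≤ n / m := (Nat.le_div_iff_mul_le hpos).2 (by rwa [mul_comm])
    have hb : n / m ≤ b := Nat.div_le_of_le_mul h2
    refine ⟨by omega, ?_⟩
    split_ifs with hif
    · by_contra! hcon
      have hb' : n / m = b := by omega
      rw [hb'] at hdm
      omega
    · omega

/-- Given two maps to a common base with controlled fibres, there is a map between their domains
over the base with controlled fibres and prescribed value at one point. -/
lemma exists_lift {S T B : Type*} (p : S → B) (ψ : T → B) {a b c d m : ℕ} (ha : 1 ≤ a)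
    (hc : 1 ≤ c) (h1 : d * a ≤ m) (h2 : m ≤ c * b)
    (hp : ∀ u, Nat.card {s // p s = u} = m)
    (hψ : ∀ u, c ≤ Nat.card {t // ψ t = u} ∧ Nat.card {t // ψ t = u} ≤ d)
    (s₀ : S) (t₀ : T) (h0 : p s₀ = ψ t₀) :
    ∃ φ : S → T, (∀ s, ψ (φ s) = p s) ∧ φ s₀ = t₀ ∧
      ∀ t, a ≤ Nat.card {s // φ s = t} ∧ Nat.card {s // φ s = t} ≤ b := by
  classical
  have hψf : ∀ u, Finite {t // ψ t = u} := fun u =>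
    Nat.finite_of_card_ne_zero (by have := (hψ u).1; omega)
  have hpf : ∀ u, Finite {s // p s = u} := fun u => by
    refine Nat.finite_of_card_ne_zero ?_
    have hd : 1 ≤ d := hc.trans ((hψ u).1.trans (hψ u).2)
    have := (Nat.mul_le_mul hd ha).trans h1
    rw [hp u]
    omega
  have hloc : ∀ u, ∃ φ : {s // p s = u} → {t // ψ t = u}, ∀ t,
      a ≤ Nat.card {s // φ s = t} ∧ Nat.card {s // φ s = t} ≤ b := by
    intro u
    have := hpf u
    have := hψf u
    refine exists_balanced_map ?_ ?_
    · rw [hp u]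
      exact (Nat.mul_le_mul_right a (hψ u).2).trans h1
    · rw [hp u]
      exact h2.trans (Nat.mul_le_mul_right b (hψ u).1)
  choose F hF using hloc
  let φ : S → T := fun s => (F (p s) ⟨s, rfl⟩).1
  have hφ : ∀ s, ψ (φ s) = p s := fun s => (F (p s) ⟨s, rfl⟩).2
  have hFφ : ∀ u (s : {s // p s = u}), (F u s).1 = φ s.1 := by
    rintro _ ⟨s, rfl⟩
    rfl
  have hfib : ∀ t, a ≤ Nat.card {s // φ s = t} ∧ Nat.card {s // φ s = t} ≤ b := by
    intro t
    have e : {s // φ s = t} ≃ {s // F (ψ t) s = ⟨t, rfl⟩} :=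
      { toFun := fun s => ⟨⟨s.1, by rw [← hφ, s.2]⟩, Subtype.ext (by rw [hFφ, s.2])⟩
        invFun := fun s => ⟨s.1.1, by rw [← hFφ, s.2]⟩
        left_inv := fun _ => rfl
        right_inv := fun _ => rfl }
    rw [Nat.card_congr e]
    exact hF (ψ t) ⟨t, rfl⟩
  obtain ⟨⟨s₁, hs₁⟩⟩ : Nonempty {s // φ s = t₀} :=
    (Nat.card_pos_iff.1 (ha.trans (hfib t₀).1)).1
  have hp01 : p s₀ = p s₁ := by rw [h0, ← hφ s₁, hs₁]
  refine ⟨φ ∘ Equiv.swap s₀ s₁, fun s => ?_, by simp [hs₁], fun t => ?_⟩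
  · rw [Function.comp_apply, hφ, Equiv.swap_apply_def]
    split_ifs with h h
    · rw [h, hp01]
    · rw [h, hp01]
    · rfl
  · have e : {s // (φ ∘ Equiv.swap s₀ s₁) s = t} ≃ {s // φ s = t} :=
      (Equiv.swap s₀ s₁).subtypeEquiv fun _ => Iff.rfl
    rw [Nat.card_congr e]
    exact hfib t

/-- Two towers of equivalence relations on countable sets have, for each height, a map between
their bottom quotients compatible with the relations up to that height, provided that the numbers
of classes inside the next classes satisfy interlacing inequalities. -/
lemma exists_finite_tower_map {X Y : Type*} [Countable X] [Countable Y] (E : ℕ → Setoid X)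
    (F : ℕ → Setoid Y) (hE : ∀ n, E n ≤ E (n + 1)) (hF : ∀ n, F n ≤ F (n + 1)) (x₀ : X) (y₀ : Y)
    (hEinf : ∀ n, Infinite (Quotient (E n))) (hFinf : ∀ n, Infinite (Quotient (F n)))
    (k l a b c d : ℕ → ℕ)
    (hk : ∀ n u, Nat.card {s : Quotient (E n) // Quotient.map id (hE n) s = u} = k n)
    (hl : ∀ n u, Nat.card {t : Quotient (F n) // Quotient.map id (hF n) t = u} = l n)
    (ha : ∀ n, 1 ≤ a n) (hab : ∀ n, a n ≤ b n) (hc : ∀ n, 1 ≤ c n)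
    (hk1 : ∀ n, d n * a n ≤ k n) (hk2 : ∀ n, k n ≤ c n * b n)
    (hl1 : ∀ n, b (n + 1) * c n ≤ l n) (hl2 : ∀ n, l n ≤ a (n + 1) * d n) (m : ℕ) :
    ∀ n, ∃ φ : Quotient (E n) → Quotient (F n), φ (Quotient.mk _ x₀) = Quotient.mk _ y₀ ∧
      (∀ t, a n ≤ Nat.card {s // φ s = t} ∧ Nat.card {s // φ s = t} ≤ b n) ∧
      ∀ i < m, ∀ x x' y y', φ (Quotient.mk _ x) = Quotient.mk _ y →
        φ (Quotient.mk _ x') = Quotient.mk _ y' →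
        (E (n + i) x x' → F (n + i) y y') ∧ (F (n + i) y y' → E (n + i + 1) x x') := by
  classical
  induction m with
  | zero =>
    intro n
    have hne : Nonempty (Fin (a n)) := ⟨⟨0, ha n⟩⟩
    have := hEinf n
    have := hFinf n
    obtain ⟨e⟩ := nonempty_equiv_of_countable (α := Quotient (E n))
      (β := Quotient (F n) × Fin (a n))
    let s₁ := e.symm (Quotient.mk _ y₀, ⟨0, ha n⟩)
    let e' := (Equiv.swap (Quotient.mk (E n) x₀) s₁).trans e
    refine ⟨fun s => (e' s).1, by simp [e', s₁], fun t => ?_, fun i hi => absurd hi (by omega)⟩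
    have hcard : Nat.card {s // (e' s).1 = t} = a n := by
      have h1 : {s // (e' s).1 = t} ≃ {z : Quotient (F n) × Fin (a n) // z.1 = t} :=
        e'.subtypeEquiv fun _ => Iff.rfl
      have h2 : {z : Quotient (F n) × Fin (a n) // z.1 = t} ≃ Fin (a n) :=
        { toFun := fun z => z.1.2
          invFun := fun i => ⟨(t, i), rfl⟩
          left_inv := by
            rintro ⟨⟨t, i⟩, rfl⟩
            rfl
          right_inv := fun _ => rfl }
      rw [Nat.card_congr (h1.trans h2), Nat.card_fin]
    rw [hcard]
    exact ⟨le_rfl, hab n⟩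
  | succ m ih =>
    intro n
    obtain ⟨φ', h0', hfib', hcomp'⟩ := ih (n + 1)
    obtain ⟨ψ, hψ, hψ0, hψfib⟩ := exists_lift (Quotient.map id (hF n)) φ' (hc n) (ha (n + 1))
      (hl1 n) (hl2 n) (hl n) hfib' (Quotient.mk _ y₀) (Quotient.mk _ x₀) h0'.symm
    obtain ⟨φ, hφ, hφ0, hφfib⟩ := exists_lift (Quotient.map id (hE n)) ψ (ha n) (hc n)
      (hk1 n) (hk2 n) (hk n) hψfib (Quotient.mk _ x₀) (Quotient.mk _ y₀) hψ0.symm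
    refine ⟨φ, hφ0, hφfib, fun i hi x x' y y' hxy hxy' => ?_⟩
    have hlift : ∀ x y, φ (Quotient.mk _ x) = Quotient.mk _ y →
        ψ (Quotient.mk _ y) = Quotient.mk _ x := fun x y h => by
      rw [← h, hφ]
      rfl
    have hlift' : ∀ x y, φ (Quotient.mk _ x) = Quotient.mk _ y →
        φ' (Quotient.mk _ x) = Quotient.mk _ y := fun x y h => by
      rw [← hlift x y h, hψ]
      rfl
    rcases i with _ | i
    · constructor
      · intro h
        have : Quotient.mk (E n) x = Quotient.mk (E n) x' := Quotient.sound h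
        rw [this] at hxy
        exact Quotient.exact (hxy.symm.trans hxy')
      · intro h
        have : Quotient.mk (F n) y = Quotient.mk (F n) y' := Quotient.sound h
        have h1 := hlift x y hxy
        rw [this] at h1
        exact Quotient.exact (h1.symm.trans (hlift x' y' hxy'))
    · have := hcomp' i (by omega) x x' y y' (hlift' x y hxy) (hlift' x' y' hxy')
      rwa [show n + 1 + i = n + (i + 1) by omega] at this

lemma exists_eventually_eq {α ι : Type*} (U : Ultrafilter ι) {g : ι → α} {s : Set α}
    (hs : s.Finite) (h : ∀ᶠ i in (U : Filter ι), g i ∈ s) :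
    ∃ t ∈ s, ∀ᶠ i in (U : Filter ι), g i = t :=
  (Ultrafilter.eventually_exists_mem_iff (P := fun t i => g i = t) hs).1
    (h.mono fun i hi => ⟨g i, hi, rfl⟩)

/-- Two exhaustive towers of equivalence relations with interlacing numbers of classes have a
surjection between the bottom quotients compatible with all the relations. -/
lemma exists_tower_map {X Y : Type*} [Countable X] [Countable Y] (E : ℕ → Setoid X)
    (F : ℕ → Setoid Y) (hE : ∀ n, E n ≤ E (n + 1)) (hF : ∀ n, F n ≤ F (n + 1)) (x₀ : X) (y₀ : Y)
    (hEx : ∀ x, ∃ n, E n x₀ x) (hFx : ∀ y, ∃ n, F n y₀ y)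
    (hEfin : ∀ n, (Quotient.mk (E 0) '' {x | E n x₀ x}).Finite)
    (hFfin : ∀ n, (Quotient.mk (F 0) '' {y | F n y₀ y}).Finite)
    (hEinf : ∀ n, Infinite (Quotient (E n))) (hFinf : ∀ n, Infinite (Quotient (F n)))
    (k l a b c d : ℕ → ℕ)
    (hk : ∀ n u, Nat.card {s : Quotient (E n) // Quotient.map id (hE n) s = u} = k n)
    (hl : ∀ n u, Nat.card {t : Quotient (F n) // Quotient.map id (hF n) t = u} = l n)
    (ha : ∀ n, 1 ≤ a n) (hab : ∀ n, a n ≤ b n) (hc : ∀ n, 1 ≤ c n)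
    (hk1 : ∀ n, d n * a n ≤ k n) (hk2 : ∀ n, k n ≤ c n * b n)
    (hl1 : ∀ n, b (n + 1) * c n ≤ l n) (hl2 : ∀ n, l n ≤ a (n + 1) * d n) :
    ∃ φ : Quotient (E 0) → Quotient (F 0), Function.Surjective φ ∧
      ∀ n x x' y y', φ (Quotient.mk _ x) = Quotient.mk _ y →
        φ (Quotient.mk _ x') = Quotient.mk _ y' →
        (E n x x' → F n y y') ∧ (F n y y' → E (n + 1) x x') := by
  choose Φ hΦ0 hΦfib hΦ using fun m => exists_finite_tower_map E F hE hF x₀ y₀ hEinf hFinf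
    k l a b c d hk hl ha hab hc hk1 hk2 hl1 hl2 m 0
  replace hΦ : ∀ m i, i < m → ∀ x x' y y', Φ m (Quotient.mk _ x) = Quotient.mk _ y →
      Φ m (Quotient.mk _ x') = Quotient.mk _ y' →
      (E i x x' → F i y y') ∧ (F i y y' → E (i + 1) x x') := fun m i => by
    have := hΦ m i
    rwa [Nat.zero_add] at this
  let U : Ultrafilter ℕ := Filter.hyperfilter ℕ
  have hU : ∀ m, ∀ᶠ N in (U : Filter ℕ), m < N := fun m =>
    Nat.hyperfilter_le_atTop (Filter.eventually_gt_atTop m)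
  have hlim : ∀ s, ∃ t, ∀ᶠ N in (U : Filter ℕ), Φ N s = t := by
    intro s
    induction s using Quotient.inductionOn with | _ x =>
    obtain ⟨m, hm⟩ := hEx x
    obtain ⟨t, -, ht⟩ := exists_eventually_eq U (hFfin m) (g := fun N => Φ N (Quotient.mk _ x))
      ((hU m).mono fun N hN => by
        obtain ⟨y, hy⟩ := Quotient.exists_rep (Φ N (Quotient.mk _ x))
        exact ⟨y, (hΦ N m hN x₀ x y₀ y (hΦ0 N) hy.symm).1 hm, hy⟩)
    exact ⟨t, ht⟩
  choose φ hφ using hlim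
  refine ⟨φ, fun t => ?_, fun n x x' y y' hxy hxy' => ?_⟩
  · induction t using Quotient.inductionOn with | _ y =>
    obtain ⟨m, hm⟩ := hFx y
    have hsurj : ∀ N, ∃ s, Φ N s = Quotient.mk _ y := fun N => by
      obtain ⟨⟨s, hs⟩⟩ := (Nat.card_pos_iff.1 ((ha 0).trans (hΦfib N (Quotient.mk _ y)).1)).1
      exact ⟨s, hs⟩
    choose g hg using hsurj
    obtain ⟨s, -, hs⟩ := exists_eventually_eq U (hEfin (m + 1)) (g := g)
      ((hU m).mono fun N hN => by
        obtain ⟨x, hx⟩ := Quotient.exists_rep (g N)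
        exact ⟨x, (hΦ N m hN x₀ x y₀ y (hΦ0 N) (by rw [hx, hg])).2 hm, hx⟩)
    obtain ⟨N, h1, h2⟩ := (hs.and (hφ s)).exists
    exact ⟨s, by rw [← h2, ← h1, hg]⟩
  · obtain ⟨N, ⟨h1, h2⟩, h3⟩ := (((hφ (Quotient.mk _ x)).and (hφ (Quotient.mk _ x'))).and
      (hU n)).exists
    exact hΦ N n h3 x x' y y' (h1.trans hxy) (h2.trans hxy')

lemma exists_interlacing_step {a b k : ℕ} (ha : 1 ≤ a) (hab : a < b) (hk : 3 * (a * b) ≤ k) :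
    ∃ c d, 1 ≤ c ∧ c < d ∧ d * a ≤ k ∧ k ≤ c * b := by
  refine ⟨k / b + 1, k / a, Nat.le_add_left _ _, ?_, Nat.div_mul_le_self k a, ?_⟩
  · rw [Nat.lt_iff_add_one_le, Nat.le_div_iff_mul_le ha]
    have h1 := Nat.div_mul_le_self k b
    have h2 : 3 * a ≤ k / b := (Nat.le_div_iff_mul_le (by omega)).2 (by linarith)
    nlinarith
  · rw [add_mul, one_mul]
    exact (Nat.lt_div_mul_add (by omega)).le

/-- Scales for two towers can be chosen so that the numbers of classes interlace. -/
lemma exists_interlacing_scales (k l : ℝ≥0 → ℝ≥0 → ℕ)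
    (hk : ∀ r M, ∃ r', r + 1 ≤ r' ∧ M ≤ k r r') (hl : ∀ r M, ∃ r', r + 1 ≤ r' ∧ M ≤ l r r')
    (p₀ q₀ : ℝ≥0) :
    ∃ (p q : ℕ → ℝ≥0) (a b c d : ℕ → ℕ), p 0 = p₀ ∧ q 0 = q₀ ∧ (∀ n, p n + 1 ≤ p (n + 1)) ∧
      (∀ n, q n + 1 ≤ q (n + 1)) ∧ (∀ n, 1 ≤ a n) ∧ (∀ n, a n ≤ b n) ∧ (∀ n, 1 ≤ c n) ∧
      (∀ n, d n * a n ≤ k (p n) (p (n + 1))) ∧ (∀ n, k (p n) (p (n + 1)) ≤ c n * b n) ∧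
      (∀ n, b (n + 1) * c n ≤ l (q n) (q (n + 1))) ∧
      (∀ n, l (q n) (q (n + 1)) ≤ a (n + 1) * d n) := by
  let S := {z : (ℝ≥0 × ℝ≥0) × (ℕ × ℕ) // 1 ≤ z.2.1 ∧ z.2.1 < z.2.2}
  have step : ∀ z : S, ∃ (z' : S) (c d : ℕ), z.1.1.1 + 1 ≤ z'.1.1.1 ∧ z.1.1.2 + 1 ≤ z'.1.1.2 ∧
      1 ≤ c ∧ d * z.1.2.1 ≤ k z.1.1.1 z'.1.1.1 ∧ k z.1.1.1 z'.1.1.1 ≤ c * z.1.2.2 ∧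
      z'.1.2.2 * c ≤ l z.1.1.2 z'.1.1.2 ∧ l z.1.1.2 z'.1.1.2 ≤ z'.1.2.1 * d := by
    rintro ⟨⟨⟨p, q⟩, a, b⟩, ha, hab⟩
    obtain ⟨p', hp', hkp⟩ := hk p (3 * (a * b))
    obtain ⟨c, d, hc, hcd, h1, h2⟩ := exists_interlacing_step ha hab hkp
    obtain ⟨q', hq', hlq⟩ := hl q (3 * (c * d))
    obtain ⟨a', b', ha', hab', h3, h4⟩ := exists_interlacing_step hc hcd hlq
    exact ⟨⟨((p', q'), (a', b')), ha', hab'⟩, c, d, hp', hq', hc, h1, h2, h3, h4⟩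
  choose next c d hnext using step
  let z : ℕ → S := fun n => Nat.rec ⟨((p₀, q₀), (1, 2)), le_rfl, one_lt_two⟩ (fun _ w => next w) n
  exact ⟨fun n => (z n).1.1.1, fun n => (z n).1.1.2, fun n => (z n).1.2.1, fun n => (z n).1.2.2,
    fun n => c (z n), fun n => d (z n), rfl, rfl, fun n => (hnext (z n)).1,
    fun n => (hnext (z n)).2.1, fun n => (z n).2.1, fun n => (z n).2.2.le,
    fun n => (hnext (z n)).2.2.1, fun n => (hnext (z n)).2.2.2.1,
    fun n => (hnext (z n)).2.2.2.2.1, fun n => (hnext (z n)).2.2.2.2.2.1,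
    fun n => (hnext (z n)).2.2.2.2.2.2⟩

end Combinatorics

section Count

variable {X : Type*} [MetricSpace X]

/-- The number of `r`-components inside the `r'`-component of `x₀`. -/
def compCount (x₀ : X) (r r' : ℝ≥0) : ℕ :=
  (Quotient.mk (compSetoid X r) '' comp X r' x₀).ncard

lemma card_fiber_eq_compCount (hX : Homogeneous X) (x₀ : X) {r r' : ℝ≥0} (h : r ≤ r')
    (u : Quotient (compSetoid X r')) :
    Nat.card {q : Quotient (compSetoid X r) // Quotient.map id (compSetoid_mono h) q = u} =
      compCount x₀ r r' := by
  induction u using Quotient.inductionOn with | _ x =>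
  obtain ⟨f, hf⟩ := hX x x₀
  refine Nat.card_congr (Equiv.subtypeEquiv (Quotient.congr f.toEquiv fun a b =>
    (isometryEquiv_mem_comp_iff f).symm) fun q => ?_)
  induction q using Quotient.inductionOn with | _ y =>
  have h1 : Quotient.map id (compSetoid_mono h) (Quotient.mk _ y) = Quotient.mk _ x ↔
      x ∈ comp X r' y := Quotient.eq
  rw [h1]
  constructor
  · intro hx
    refine ⟨f y, ?_, rfl⟩
    rw [← hf]
    exact isometryEquiv_mem_comp f (mem_comp_symm hx)
  · rintro ⟨z, hz, hzy⟩
    have hzy' : f y ∈ comp X r z := Quotient.exact hzy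
    have := mem_comp_trans hz (mem_comp_mono (by exact_mod_cast h) hzy')
    rw [← hf, isometryEquiv_mem_comp_iff] at this
    exact mem_comp_symm this

lemma LargeScaleConnected.of_finite_quotient {r : ℝ≥0}
    (h : Finite (Quotient (compSetoid X r))) :
    LargeScaleConnected X := by
  rcases isEmpty_or_nonempty X with _ | ⟨⟨x₀⟩⟩
  · exact ⟨0, ENNReal.zero_ne_top, fun x => isEmptyElim x⟩
  obtain ⟨R, hR⟩ := (Set.finite_range fun q : Quotient (compSetoid X r) =>
    nndist x₀ q.out).bddAbove
  have h1 : ∀ x, x ∈ comp X (max r R : ℝ≥0) x₀ := fun x => by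
    have h2 : x ∈ comp X r (Quotient.mk (compSetoid X r) x).out :=
      Quotient.exact (s := compSetoid X r) (Quotient.out_eq _)
    refine mem_comp_trans (mem_comp_of_dist_le ?_)
      (mem_comp_mono (ENNReal.coe_le_coe.2 (le_max_left r R)) h2)
    exact_mod_cast (hR ⟨_, rfl⟩).trans (le_max_right r R)
  exact ⟨(max r R : ℝ≥0), ENNReal.coe_ne_top, fun x y =>
    mem_comp_trans (mem_comp_symm (h1 x)) (h1 y)⟩

lemma exists_le_compCount (hX : ¬ LargeScaleConnected X) (x₀ : X) {r : ℝ≥0}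
    (hr : (r : ℝ≥0∞) ∈ ssSet X) (M : ℕ) (t : ℝ≥0) : ∃ r', t ≤ r' ∧ M ≤ compCount x₀ r r' := by
  have : Infinite (Quotient (compSetoid X r)) := by
    rw [← not_finite_iff_infinite]
    exact fun h => hX (.of_finite_quotient h)
  obtain ⟨s, hs⟩ := Infinite.exists_subset_card_eq (Quotient (compSetoid X r)) M
  obtain ⟨R, hR⟩ := (s.finite_toSet.image fun q => nndist x₀ q.out).bddAbove
  refine ⟨max t R, le_max_left _ _, ?_⟩
  rw [← hs, compCount, ← Set.ncard_coe_finset]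
  refine Set.ncard_le_ncard (fun q hq => ⟨q.out, mem_comp_of_dist_le ?_, Quotient.out_eq q⟩)
    (finite_image_mk_comp hr _ _)
  exact_mod_cast (hR ⟨q, hq, rfl⟩).trans (le_max_right t R)

lemma exists_le_compCount_add (hX : ¬ LargeScaleConnected X) (x₀ : X) {s : ℝ≥0}
    (hs : (s : ℝ≥0∞) ∈ ssSet X) (r : ℝ≥0) (M : ℕ) :
    ∃ r', r + 1 ≤ r' ∧ M ≤ compCount x₀ (s + r) (s + r') := by
  obtain ⟨r', h1, h2⟩ := exists_le_compCount hX x₀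
    (ssSet_mono hs (ENNReal.coe_le_coe.2 (le_self_add : s ≤ s + r))) M (s + (r + 1))
  obtain ⟨r'', rfl⟩ := exists_add_of_le (le_self_add.trans h1)
  exact ⟨r'', le_of_add_le_add_left h1, h2⟩

lemma BoundedlyFinite.countable (hX : BoundedlyFinite X) : Countable X := by
  rcases isEmpty_or_nonempty X with h | ⟨⟨x₀⟩⟩
  · infer_instance
  rw [← Set.countable_univ_iff, ← Metric.iUnion_closedBall_nat x₀]
  exact Set.countable_iUnion fun n => (hX _ Metric.isBounded_closedBall).countable

end Count

section Coarse

variable {X Y Z : Type*} [MetricSpace X] [MetricSpace Y] [MetricSpace Z]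

lemma coarseMapM_iff {f : X → Y} :
    CoarseMapM f ↔ ∀ δ : ℝ≥0, ∃ R : ℝ≥0, ∀ x x', dist x x' ≤ δ → dist (f x) (f x') ≤ R := by
  have hosc : ∀ (δ R : ℝ≥0),
      osc f δ ≤ R ↔ ∀ x x', dist x x' ≤ δ → dist (f x) (f x') ≤ R := fun δ R => by
    simp only [osc, iSup_le_iff, edist_dist, ENNReal.ofReal_le_coe]
  constructor
  · intro h δ
    lift osc f δ to ℝ≥0 using h δ ENNReal.coe_ne_top with R hR
    exact ⟨R, (hosc δ R).1 hR.ge⟩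
  · intro h δ hδ
    lift δ to ℝ≥0 using hδ
    obtain ⟨R, hR⟩ := h δ
    exact ne_top_of_le_ne_top ENNReal.coe_ne_top ((hosc δ R).2 hR)

lemma CoarseMapM.exists_dist_le {f : X → Y} (hf : CoarseMapM f) (δ : ℝ) :
    ∃ R : ℝ≥0, ∀ x x', dist x x' ≤ δ → dist (f x) (f x') ≤ R := by
  obtain ⟨R, hR⟩ := coarseMapM_iff.1 hf δ.toNNReal
  exact ⟨R, fun x x' h => hR x x' (h.trans (Real.le_coe_toNNReal δ))⟩

lemma CoarseMapM.exists_mem_comp {f : X → Y} (hf : CoarseMapM f) (δ : ℝ≥0) :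
    ∃ R : ℝ≥0, ∀ r : ℝ≥0, R ≤ r → ∀ x, ∀ x' ∈ comp X δ x, f x' ∈ comp Y r (f x) := by
  obtain ⟨R, hR⟩ := hf.exists_dist_le δ
  refine ⟨R, fun r hr x x' h => mem_comp_mono (ENNReal.coe_le_coe.2 hr) ?_⟩
  refine Relation.ReflTransGen.lift f (fun a b hab => ?_) _ _ h
  rw [edist_dist, ENNReal.ofReal_le_coe] at hab
  change edist (f a) (f b) ≤ R
  rw [edist_dist, ENNReal.ofReal_le_coe]
  exact hR a b hab

protected lemma CoarseMapM.comp {g : Y → Z} {f : X → Y} (hg : CoarseMapM g) (hf : CoarseMapM f) :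
    CoarseMapM (g ∘ f) := by
  refine coarseMapM_iff.2 fun δ => ?_
  obtain ⟨R, hR⟩ := hf.exists_dist_le δ
  obtain ⟨R', hR'⟩ := hg.exists_dist_le R
  exact ⟨R', fun x x' h => hR' _ _ (hR x x' h)⟩

lemma CoarselyEquivalent.symm (h : CoarselyEquivalent X Y) : CoarselyEquivalent Y X := by
  obtain ⟨f, hf, g, hg, h1, h2⟩ := h
  exact ⟨g, hg, f, hf, h2, h1⟩

lemma CoarseMapM.exists_dist_comp_le {W : Type*} {f : X → Y} {g : Y → X} {f' : Y → W} {g' : W → Y}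
    (hg : CoarseMapM g) (h : ∃ M : ℝ, ∀ x, dist x (g (f x)) ≤ M)
    (h' : ∃ M : ℝ, ∀ y, dist y (g' (f' y)) ≤ M) :
    ∃ M : ℝ, ∀ x, dist x ((g ∘ g') ((f' ∘ f) x)) ≤ M := by
  obtain ⟨M, hM⟩ := h
  obtain ⟨M', hM'⟩ := h'
  obtain ⟨R, hR⟩ := hg.exists_dist_le M'
  exact ⟨M + R, fun x => (dist_triangle _ (g (f x)) _).trans
    (add_le_add (hM x) (hR _ _ (hM' (f x))))⟩

lemma CoarselyEquivalent.trans (h : CoarselyEquivalent X Y) (h' : CoarselyEquivalent Y Z) :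
    CoarselyEquivalent X Z := by
  obtain ⟨f, hf, g, hg, h1, h2⟩ := h
  obtain ⟨f', hf', g', hg', h1', h2'⟩ := h'
  exact ⟨f' ∘ f, hf'.comp hf, g ∘ g', hg.comp hg', hg.exists_dist_comp_le h1 h1',
    hf'.exists_dist_comp_le h2' h2⟩

lemma CoarselyEquivalent.largeScaleConnected (h : CoarselyEquivalent X Y)
    (hX : LargeScaleConnected X) : LargeScaleConnected Y := by
  obtain ⟨f, hf, g, -, -, M, hM⟩ := h
  obtain ⟨δ, hδ, hX⟩ := hX
  lift δ to ℝ≥0 using hδ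
  obtain ⟨R, hR⟩ := hf.exists_mem_comp δ
  have hM' : ∀ y, f (g y) ∈ comp Y (max R M.toNNReal : ℝ≥0) y := fun y =>
    mem_comp_of_dist_le ((hM y).trans ((Real.le_coe_toNNReal M).trans
      (by exact_mod_cast le_max_right _ _)))
  exact ⟨(max R M.toNNReal : ℝ≥0), ENNReal.coe_ne_top, fun x y => mem_comp_trans (hM' x)
    (mem_comp_trans (hR _ (le_max_left _ _) _ _ (hX (g x) (g y))) (mem_comp_symm (hM' y)))⟩

lemma CoarselyEquivalent.sStep_ne_top (h : CoarselyEquivalent X Y) (hX : sStep X ≠ ⊤) :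
    sStep Y ≠ ⊤ := by
  obtain ⟨f, hf, g, hg, -, M, hM⟩ := h
  obtain ⟨e, he⟩ := exists_mem_ssSet_of_sStep_ne_top hX
  obtain ⟨R, hR⟩ := hf.exists_mem_comp e
  let s : ℝ≥0 := max R M.toNNReal
  have hM' : ∀ y, f (g y) ∈ comp Y s y := fun y =>
    mem_comp_of_dist_le ((hM y).trans ((Real.le_coe_toNNReal M).trans
      (by exact_mod_cast le_max_right _ _)))
  refine ne_top_of_le_ne_top ENNReal.coe_ne_top (sInf_le (?_ : (s : ℝ≥0∞) ∈ ssSet Y))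
  intro δ hδ _ y
  lift δ to ℝ≥0 using hδ
  obtain ⟨R', hR'⟩ := hg.exists_mem_comp δ
  have hfin := finite_image_mk_comp he R' (g y)
  refine (hfin.image fun q => comp Y s (f q.out)).subset ?_
  rintro _ ⟨z, hz, rfl⟩
  refine ⟨_, ⟨g z, hR' _ le_rfl _ _ hz, rfl⟩, comp_eq_comp_iff.2 ?_⟩
  exact mem_comp_trans (hR s (le_max_left _ _) _ _
    (Quotient.exact (s := compSetoid X e) (Quotient.out_eq _))) (mem_comp_symm (hM' z))

end Coarse

section Classification

variable {X Y : Type*} [MetricSpace X] [MetricSpace Y]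

lemma coarselyEquivalent_subtype {C : Set X} {ρ : X → X} (hρ : ∀ x, ρ x ∈ C) {R : ℝ}
    (hR : ∀ x, dist (ρ x) x ≤ R) : CoarselyEquivalent C X := by
  refine ⟨Subtype.val, coarseMapM_iff.2 fun δ => ⟨δ, fun x x' h => h⟩, fun x => ⟨ρ x, hρ x⟩,
    coarseMapM_iff.2 fun δ => ⟨δ + 2 * R.toNNReal, fun x x' h => ?_⟩,
    ⟨R, fun x => dist_comm (ρ x) x ▸ hR x⟩, ⟨R, fun x => dist_comm (ρ x) x ▸ hR x⟩⟩
  have h1 := dist_triangle4 (ρ x) x x' (ρ x')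
  have h2 := hR x
  have h3 := hR x'
  have h4 := Real.le_coe_toNNReal R
  rw [dist_comm] at h3
  rw [Subtype.dist_eq]
  push_cast
  linarith

lemma coarselyEquivalent_comp_top (x₀ : X) : CoarselyEquivalent (comp X ⊤ x₀) X :=
  coarselyEquivalent_subtype (ρ := id) (fun _ => mem_comp_of_edist_le le_top)
    fun x => (dist_self x).le

lemma largeScaleConnected_comp (r : ℝ≥0) (x₀ : X) : LargeScaleConnected (comp X r x₀) := by
  have key : ∀ y (hy : y ∈ comp X r x₀),
      (⟨y, hy⟩ : comp X r x₀) ∈ comp (comp X r x₀) r ⟨x₀, mem_comp_self _ _⟩ := by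
    intro y hy
    induction hy with
    | refl => exact mem_comp_self _ _
    | tail hb hbc ih => exact mem_comp_trans ih (mem_comp_of_edist_le hbc)
  exact ⟨r, ENNReal.coe_ne_top, fun x y =>
    mem_comp_trans (mem_comp_symm (key x.1 x.2)) (key y.1 y.2)⟩

lemma CoarseMapM.exists_near_map_comp {f : X → Y} (hf : CoarseMapM f) (hY : ShiftHomogeneous Y)
    (x₀ : X) (y₀ : Y) (s : ℝ≥0) {t : ℝ≥0} (ht : (t : ℝ≥0∞) ∈ ssSet Y) :
    ∃ F : comp X s x₀ → comp Y t y₀, CoarseMapM F ∧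
      ∃ R : ℝ, ∀ c, dist (F c : Y) (f c) ≤ R := by
  obtain ⟨ρ, -, hmem, -, hρ⟩ := exists_retraction hY y₀ ht
  obtain ⟨r, hr⟩ := hf.exists_mem_comp s
  obtain ⟨R, hR⟩ := hρ (max r (nndist y₀ (f x₀)))
  have hR' : ∀ x ∈ comp X s x₀, dist (ρ (f x)) (f x) ≤ R := fun x hx =>
    hR _ (mem_comp_trans (mem_comp_of_dist_le (by exact_mod_cast le_max_right _ _))
      (hr _ (le_max_left _ _) _ _ hx))
  refine ⟨fun c => ⟨ρ (f c), hmem _⟩, coarseMapM_iff.2 fun δ => ?_, R, fun c => hR' c c.2⟩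
  obtain ⟨K, hK⟩ := hf.exists_dist_le δ
  refine ⟨K + 2 * R.toNNReal, fun x x' h => ?_⟩
  have h1 := dist_triangle4 (ρ (f x)) (f x) (f x') (ρ (f x'))
  have h2 := hR' x x.2
  have h3 := hR' x' x'.2
  have h4 := Real.le_coe_toNNReal R
  have h5 := hK _ _ h
  rw [dist_comm] at h3
  rw [Subtype.dist_eq]
  push_cast
  linarith

protected lemma CoarselyEquivalent.comp (h : CoarselyEquivalent X Y) (hX : ShiftHomogeneous X)
    (hY : ShiftHomogeneous Y) (x₀ : X) (y₀ : Y) {s t : ℝ≥0} (hs : (s : ℝ≥0∞) ∈ ssSet X)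
    (ht : (t : ℝ≥0∞) ∈ ssSet Y) : CoarselyEquivalent (comp X s x₀) (comp Y t y₀) := by
  obtain ⟨f, hf, g, hg, ⟨M, hM⟩, M', hM'⟩ := h
  obtain ⟨F, hF, R, hR⟩ := hf.exists_near_map_comp hY x₀ y₀ s ht
  obtain ⟨G, hG, R', hR'⟩ := hg.exists_near_map_comp hX y₀ x₀ t hs
  obtain ⟨K, hK⟩ := hg.exists_dist_le R
  obtain ⟨K', hK'⟩ := hf.exists_dist_le R'
  refine ⟨F, hF, G, hG, ⟨M + K + R', fun c => ?_⟩, M' + K' + R, fun c => ?_⟩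
  · have h1 := dist_triangle4 (c : X) (g (f c)) (g (F c)) (G (F c))
    have h2 := hM c
    have h3 := hK _ _ (hR c)
    have h4 := hR' (F c)
    rw [dist_comm] at h3 h4
    rw [Subtype.dist_eq]
    linarith
  · have h1 := dist_triangle4 (c : Y) (f (g c)) (f (G c)) (F (G c))
    have h2 := hM' c
    have h3 := hK' _ _ (hR' c)
    have h4 := hR (G c)
    rw [dist_comm] at h3 h4
    rw [Subtype.dist_eq]
    linarith

lemma coarselyEquivalent_comp_of_largeScaleConnected (hX : ShiftHomogeneous X)
    (hXc : LargeScaleConnected X) (x₀ : X) {s : ℝ≥0} (hs : (s : ℝ≥0∞) ∈ ssSet X) :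
    CoarselyEquivalent (comp X s x₀) X := by
  obtain ⟨ρ, -, hmem, -, hρ⟩ := exists_retraction hX x₀ hs
  obtain ⟨δ, hδ, hc⟩ := hXc
  lift δ to ℝ≥0 using hδ
  obtain ⟨R, hR⟩ := hρ δ
  exact coarselyEquivalent_subtype hmem fun x => hR x (hc x₀ x)

/-- A map covering a coarse map of the bases and respecting the towers of components is coarse. -/
lemma coarseMapM_of_projection {C D : Type*} [MetricSpace C] [MetricSpace D] {π : X → C}
    {π' : Y → D} {h : C → D} {F : X → Y} {p q : ℕ → ℝ≥0} (hh : CoarseMapM h)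
    (hp : ∀ n : ℕ, n ≤ p n)
    (hπ : ∀ n, ∃ R : ℝ, ∀ x, ∀ x' ∈ comp X (p n) x, |dist (π x) (π x') - dist x x'| ≤ R)
    (hπ' : ∀ n, ∃ R : ℝ, ∀ y, ∀ y' ∈ comp Y (q n) y, |dist (π' y) (π' y') - dist y y'| ≤ R)
    (hF : ∀ x, π' (F x) = h (π x))
    (hc : ∀ n, ∃ m, ∀ x, ∀ x' ∈ comp X (p n) x, F x' ∈ comp Y (q m) (F x)) :
    CoarseMapM F := by
  refine coarseMapM_iff.2 fun δ => ?_
  obtain ⟨n, hn⟩ := exists_nat_ge δ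
  obtain ⟨m, hm⟩ := hc n
  obtain ⟨R, hR⟩ := hπ n
  obtain ⟨R', hR'⟩ := hπ' m
  obtain ⟨K, hK⟩ := hh.exists_dist_le (δ + R)
  refine ⟨K + R'.toNNReal, fun x x' hx => ?_⟩
  have h1 : x' ∈ comp X (p n) x := mem_comp_of_dist_le
    (hx.trans (by exact_mod_cast hn.trans (hp n)))
  have h2 := abs_le.1 (hR x x' h1)
  have h3 := abs_le.1 (hR' _ _ (hm x x' h1))
  rw [hF, hF] at h3
  have h4 := hK (π x) (π x') (by linarith)
  have h5 := Real.le_coe_toNNReal R'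
  push_cast
  linarith

lemma exists_dist_le_of_projection {C : Type*} [MetricSpace C] {π : X → C} {p : ℝ≥0} {H : X → X}
    {k : C → C} (hπ : ∃ R : ℝ, ∀ x, ∀ x' ∈ comp X p x, |dist (π x) (π x') - dist x x'| ≤ R)
    (hk : ∃ M : ℝ, ∀ c, dist c (k c) ≤ M) (hH : ∀ x, π (H x) = k (π x))
    (hc : ∀ x, H x ∈ comp X p x) : ∃ M : ℝ, ∀ x, dist x (H x) ≤ M := by
  obtain ⟨R, hR⟩ := hπ
  obtain ⟨M, hM⟩ := hk
  refine ⟨M + R, fun x => ?_⟩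
  have h1 := abs_le.1 (hR x _ (hc x))
  have h2 := hM (π x)
  rw [hH] at h1
  linarith

lemma coarselyEquivalent_of_comp (hX : ShiftHomogeneous X) (hY : ShiftHomogeneous Y)
    (hXb : BoundedlyFinite X) (hYb : BoundedlyFinite Y) (hXc : ¬ LargeScaleConnected X)
    (hYc : ¬ LargeScaleConnected Y) {x₀ : X} {y₀ : Y} {s t : ℝ≥0} (hs : (s : ℝ≥0∞) ∈ ssSet X)
    (ht : (t : ℝ≥0∞) ∈ ssSet Y) (h : CoarselyEquivalent (comp X s x₀) (comp Y t y₀)) :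
    CoarselyEquivalent X Y := by
  obtain ⟨p, q, a, b, c, d, hp0, hq0, hp, hq, ha, hab, hc, hk1, hk2, hl1, hl2⟩ :
      ∃ (p q : ℕ → ℝ≥0) (a b c d : ℕ → ℕ), p 0 = s ∧ q 0 = t ∧ (∀ n, p n + 1 ≤ p (n + 1)) ∧
      (∀ n, q n + 1 ≤ q (n + 1)) ∧ (∀ n, 1 ≤ a n) ∧ (∀ n, a n ≤ b n) ∧ (∀ n, 1 ≤ c n) ∧
      (∀ n, d n * a n ≤ compCount x₀ (p n) (p (n + 1))) ∧
      (∀ n, compCount x₀ (p n) (p (n + 1)) ≤ c n * b n) ∧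
      (∀ n, b (n + 1) * c n ≤ compCount y₀ (q n) (q (n + 1))) ∧
      (∀ n, compCount y₀ (q n) (q (n + 1)) ≤ a (n + 1) * d n) := by
    obtain ⟨p, q, a, b, c, d, hp0, hq0, hp, hq, h⟩ := exists_interlacing_scales _ _
      (exists_le_compCount_add hXc x₀ hs) (exists_le_compCount_add hYc y₀ ht) 0 0
    refine ⟨fun n => s + p n, fun n => t + q n, a, b, c, d, by simp [hp0], by simp [hq0],
      fun n => ?_, fun n => ?_, h⟩
    · rw [add_assoc]
      exact add_le_add_right (hp n) s
    · rw [add_assoc]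
      exact add_le_add_right (hq n) t
  subst hp0 hq0
  have hge : ∀ {p : ℕ → ℝ≥0}, (∀ n, p n + 1 ≤ p (n + 1)) → ∀ n : ℕ, n ≤ p n := by
    intro p hp n
    induction n with
    | zero => simp
    | succ n ih => exact_mod_cast (add_le_add_left ih 1).trans (hp n)
  have hpm : Monotone p := monotone_nat_of_le_succ fun n => le_self_add.trans (hp n)
  have hqm : Monotone q := monotone_nat_of_le_succ fun n => le_self_add.trans (hq n)
  have hex : ∀ x, ∃ n, x ∈ comp X (p n) x₀ := fun x => by
    obtain ⟨n, hn⟩ := exists_nat_ge (nndist x₀ x)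
    exact ⟨n, mem_comp_of_dist_le (by exact_mod_cast hn.trans (hge hp n))⟩
  have hey : ∀ y, ∃ n, y ∈ comp Y (q n) y₀ := fun y => by
    obtain ⟨n, hn⟩ := exists_nat_ge (nndist y₀ y)
    exact ⟨n, mem_comp_of_dist_le (by exact_mod_cast hn.trans (hge hq n))⟩
  have := hXb.countable
  have := hYb.countable
  obtain ⟨φ, hφ, hφc⟩ := exists_tower_map (fun n => compSetoid X (p n))
    (fun n => compSetoid Y (q n)) (fun n => compSetoid_mono (hpm n.le_succ))
    (fun n => compSetoid_mono (hqm n.le_succ)) x₀ y₀ hex hey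
    (fun n => finite_image_mk_comp hs (p n) x₀) (fun n => finite_image_mk_comp ht (q n) y₀)
    (fun n => not_finite_iff_infinite.1 fun h => hXc (.of_finite_quotient h))
    (fun n => not_finite_iff_infinite.1 fun h => hYc (.of_finite_quotient h)) _ _ a b c d
    (fun n => card_fiber_eq_compCount hX.homogeneous x₀ (hpm n.le_succ))
    (fun n => card_fiber_eq_compCount hY.homogeneous y₀ (hqm n.le_succ))
    ha hab hc hk1 hk2 hl1 hl2
  obtain ⟨π, hπ, hπd⟩ := exists_projection hX x₀ p hpm hs hex
  obtain ⟨π', hπ', hπd'⟩ := exists_projection hY y₀ q hqm ht hey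
  obtain ⟨f, hf, g, hg, hgf, hfg⟩ := h
  have hF : ∀ x, ∃ y, φ (Quotient.mk _ x) = Quotient.mk _ y ∧ π' y = f (π x) := fun x => by
    obtain ⟨y, hy⟩ := Quotient.exists_rep (φ (Quotient.mk _ x))
    obtain ⟨y', h1, h2⟩ := hπ' y (f (π x))
    exact ⟨y', hy.symm.trans (Quotient.sound h1), h2⟩
  have hG : ∀ y, ∃ x, φ (Quotient.mk _ x) = Quotient.mk _ y ∧ π x = g (π' y) := fun y => by
    obtain ⟨u, hu⟩ := hφ (Quotient.mk _ y)
    obtain ⟨x, rfl⟩ := Quotient.exists_rep u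
    obtain ⟨x', h1, h2⟩ := hπ x (g (π' y))
    exact ⟨x', hu ▸ congrArg φ (Quotient.sound h1).symm, h2⟩
  choose F hF1 hF2 using hF
  choose G hG1 hG2 using hG
  refine ⟨F, coarseMapM_of_projection hf (hge hp) hπd hπd' hF2 fun n => ⟨n, fun x x' h =>
      (hφc n x x' _ _ (hF1 x) (hF1 x')).1 h⟩,
    G, coarseMapM_of_projection hg (hge hq) hπd' hπd hG2 fun n => ⟨n + 1, fun y y' h =>
      (hφc n _ _ y y' (hG1 y) (hG1 y')).2 h⟩,
    exists_dist_le_of_projection (hπd 1) hgf (fun x => by simp only [hG2, hF2])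
      fun x => (hφc 0 _ _ _ _ (hF1 x) (hG1 (F x))).2 (mem_comp_self _ _),
    exists_dist_le_of_projection (hπd' 0) hfg (fun y => by simp only [hG2, hF2])
      fun y => Quotient.exact (s := compSetoid Y (q 0)) ((hG1 y).symm.trans (hF1 (G y)))⟩

/-- If the factorizing components are coarsely equivalent and one factorizing step is finite, then
so is the other one, since a component of finite scale is large scale connected. -/
lemma sStep_ne_top_of_comp {x₀ : X} {y₀ : Y}
    (h : CoarselyEquivalent (comp X (sStep X) x₀) (comp Y (sStep Y) y₀)) (hX : sStep X ≠ ⊤) :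
    sStep Y ≠ ⊤ := by
  intro hY
  rw [hY] at h
  generalize sStep X = s at h hX
  lift s to ℝ≥0 using hX
  exact ((h.trans (coarselyEquivalent_comp_top y₀)).largeScaleConnected
    (largeScaleConnected_comp s x₀)).sStep_ne_top hY

end Classification

/-- Theorem 1.3: two shift-homogeneous boundedly-finite metric spaces are coarsely equivalent
iff their factorizing components are coarsely equivalent and the two spaces are either both
large scale connected or both not large scale connected.  (By homogeneity all `s(X)`-connected
components are isometric, so we use the components of given basepoints.) -/
theorem coarse_equivalence_classification_of_shift_homogeneous_spaces
    (X Y : Type*) [MetricSpace X] [MetricSpace Y]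
    (hX : ShiftHomogeneous X) (hY : ShiftHomogeneous Y)
    (hXb : BoundedlyFinite X) (hYb : BoundedlyFinite Y) (x₀ : X) (y₀ : Y) :
    CoarselyEquivalent X Y ↔
      (CoarselyEquivalent ↥(comp X (sStep X) x₀) ↥(comp Y (sStep Y) y₀) ∧
        (LargeScaleConnected X ↔ LargeScaleConnected Y)) := by
  have hsX := sStep_mem_ssSet hX.homogeneous hXb
  have hsY := sStep_mem_ssSet hY.homogeneous hYb
  constructor
  · refine fun h => ⟨?_, h.largeScaleConnected, h.symm.largeScaleConnected⟩
    by_cases hs : sStep X = ⊤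
    · have ht : sStep Y = ⊤ := by_contra fun ht => h.symm.sStep_ne_top ht hs
      rw [hs, ht]
      exact ((coarselyEquivalent_comp_top x₀).trans h).trans (coarselyEquivalent_comp_top y₀).symm
    · have ht := h.sStep_ne_top hs
      generalize sStep X = s at *
      generalize sStep Y = t at *
      lift s to ℝ≥0 using hs
      lift t to ℝ≥0 using ht
      exact h.comp hX hY x₀ y₀ hsX hsY
  · rintro ⟨h, hc⟩
    by_cases hs : sStep X = ⊤
    · have ht : sStep Y = ⊤ := by_contra fun ht => sStep_ne_top_of_comp h.symm ht hs
      rw [hs, ht] at h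
      exact ((coarselyEquivalent_comp_top x₀).symm.trans h).trans (coarselyEquivalent_comp_top y₀)
    · have ht := sStep_ne_top_of_comp h hs
      generalize sStep X = s at *
      generalize sStep Y = t at *
      lift s to ℝ≥0 using hs
      lift t to ℝ≥0 using ht
      by_cases hXc : LargeScaleConnected X
      · exact ((coarselyEquivalent_comp_of_largeScaleConnected hX hXc x₀ hsX).symm.trans h).trans
          (coarselyEquivalent_comp_of_largeScaleConnected hY (hc.1 hXc) y₀ hsY)
      · exact coarselyEquivalent_of_comp hX hY hXb hYb hXc (fun h => hXc (hc.2 h)) hsX hsY h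

end
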